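/- Let μ = Σ_{j=1}^{s} c_j δ_{t_j} with distinct t_j ∈ [0,Λ] and c ∈ ℂ^s, and let its Fourier transform be μ̂(ω) = Σ_{j=1}^{s} c_j e^{-2πi ω t_j}. If μ̂ vanishes at more than (1 + 6/ln(s/(ΛΩ)))·s points of [-Ω, Ω] (with s > ΛΩ), then all coefficients c_j are zero. -/

import Mathlib

open Complex Real

/-- A parameter choice balancing the growth and zero estimates. -/
lemma exists_radius_log_le {a : ℝ} (ha : 1 < a) :
    ∃ T : ℝ, 7 / 2 ≤ T ∧
      Real.log 5 + π / a * (T + 1 / 4) ≤ 6 / Real.log a * Real.log (T / (5 / 4)) := by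
  have ha0 : 0 < a := by linarith
  have hL : 0 < Real.log a := Real.log_pos ha
  have haL : Real.exp (Real.log a) = a := Real.exp_log ha0
  set L := Real.log a with hLdef
  have h5 : Real.log 5 < 1.6095 := by
    have := abs_le.1 Real.log_five_near_10; norm_num at *; linarith [this.2]
  have h2 := Real.log_two_gt_d9
  have h2' := Real.log_two_lt_d9
  have hpi := Real.pi_lt_d4
  have he := Real.exp_one_gt_d9
  rcases le_total L 2.1 with h | h
  · refine ⟨5, by norm_num, ?_⟩
    have h4 : Real.log (5 / (5 / 4)) = 2 * Real.log 2 := by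
      rw [show (5 : ℝ) / (5 / 4) = 2 ^ 2 by norm_num, Real.log_pow]; norm_num
    rw [h4]
    suffices 16.494 * L ≤ (8.3177 - 1.6095 * L) * a by
      have h1 : π / a * (5 + 1 / 4) ≤ 16.494 / a := by
        rw [div_mul_eq_mul_div]; gcongr; linarith
      have h3 : 8.3177 / L ≤ 6 / L * (2 * Real.log 2) := by
        rw [div_mul_eq_mul_div]; gcongr; linarith
      have h6 : 16.494 / a ≤ 8.3177 / L - 1.6095 := by
        rw [div_le_iff₀ ha0, sub_mul, div_mul_eq_mul_div, le_sub_iff_add_le, le_div_iff₀ hL]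
        linarith
      linarith
    rcases le_total L 1.3 with h' | h'
    · have hx : 2.718 * L ≤ a := by
        have h1 : Real.exp L = Real.exp 1 * Real.exp (L - 1) := by
          rw [← Real.exp_add]; congr 1; ring
        have h3 := Real.add_one_le_exp (L - 1)
        rw [haL] at h1
        rw [h1]
        nlinarith
      nlinarith
    · have hx : 4.48 * (L - 0.5) ≤ a := by
        have h1 : Real.exp L = Real.exp 1.5 * Real.exp (L - 1.5) := by
          rw [← Real.exp_add]; congr 1; ring
        have h3 := Real.add_one_le_exp (L - 1.5)
        have h6 : (4.48 : ℝ) ≤ Real.exp 1.5 := by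
          have h7 : Real.exp 1.5 ^ 2 = Real.exp 1 ^ 3 := by
            rw [← Real.exp_nat_mul, ← Real.exp_nat_mul]; norm_num
          have h8 : (2.7182 : ℝ) ^ 3 ≤ Real.exp 1 ^ 3 := by gcongr; linarith
          refine le_of_sq_le_sq ?_ (Real.exp_pos _).le
          rw [h7]; norm_num at h8 ⊢; linarith
        rw [haL] at h1
        rw [h1]
        nlinarith
      nlinarith
  · have ha7 : 7 ≤ a := by
      have h1 : Real.exp 2 ≤ a := by rw [← haL]; gcongr; linarith
      have h3 : Real.exp 2 = Real.exp 1 ^ 2 := by rw [← Real.exp_nat_mul]; norm_num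
      nlinarith
    refine ⟨a / 2, by linarith, ?_⟩
    have h1 : Real.log (a / 2 / (5 / 4)) = L - Real.log 5 + Real.log 2 := by
      rw [show a / 2 / (5 / 4) = a * 2 / 5 by ring, Real.log_div (by positivity) (by norm_num),
        Real.log_mul (by positivity) (by norm_num)]
      ring
    have h3 : π / a * (a / 2 + 1 / 4) = π / 2 + π / 4 * (1 / a) := by field_simp
    have h4 : 1 / a ≤ 1 / 7 := by gcongr
    have h6 : π / 4 * (1 / a) ≤ 0.1123 := by
      have : π / 4 * (1 / a) ≤ (3.1416 / 4) * (1 / 7) := by gcongr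
      norm_num at *; linarith
    rw [h1, h3]
    have h7 : 3.293 ≤ 6 / L * (L - Real.log 5 + Real.log 2) := by
      rw [div_mul_eq_mul_div, le_div_iff₀ hL]
      linarith
    linarith

/-- Zeros force decay: each zero in `[-1, 1]` gains a factor `(5/4)/T` on the disc of
radius `1/4`. -/
lemma norm_le_of_zeros {T M : ℝ} (hT : 5 / 4 < T) (Z : Finset ℝ) :
    ∀ g : ℂ → ℂ, Differentiable ℂ g → (∀ z, ‖z‖ = T → ‖g z‖ ≤ M) →
      (∀ x ∈ Z, |x| ≤ 1 ∧ g x = 0) → ∀ z : ℂ, ‖z‖ ≤ 1 / 4 → ‖g z‖ ≤ M * (5 / 4 / T) ^ Z.card := by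
  have hT0 : 0 < T := by linarith
  induction Z using Finset.induction_on with
  | empty =>
    intro g hg hM _ z hz
    simp only [Finset.card_empty, pow_zero, mul_one]
    refine Complex.norm_le_of_forall_mem_frontier_norm_le (U := Metric.ball 0 T)
      Metric.isBounded_ball hg.diffContOnCl (fun w hw => hM w ?_) ?_
    · rw [frontier_ball _ hT0.ne'] at hw
      simpa using hw
    · rw [closure_ball _ hT0.ne']
      simp only [mem_closedBall_zero_iff]; linarith
  | insert a Z haZ ih =>
    intro g hg hM hz z hz'
    obtain ⟨ha1, hga⟩ := hz a (Finset.mem_insert_self _ _)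
    have key : ∀ w, g w = (w - a) * dslope g a w := fun w => by
      have := sub_smul_dslope g (a : ℂ) w
      rw [hga, sub_zero, smul_eq_mul] at this
      exact this.symm
    have hd : Differentiable ℂ (dslope g a) := by
      rw [← differentiableOn_univ, Complex.differentiableOn_dslope Filter.univ_mem]
      exact hg.differentiableOn
    have hsq : ∀ w : ℂ, ‖w‖ ^ 2 = w.re ^ 2 + w.im ^ 2 := fun w => by
      rw [Complex.sq_norm, Complex.normSq_apply]; ring
    have hB := ih (fun w => dslope g a w * ((T ^ 2 - a * w) / T)) (by fun_prop) ?_ ?_ z hz'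
    · rw [Finset.card_insert_of_notMem haZ, pow_succ]
      have hq : ‖z - a‖ ≤ 5 / 4 / T * ‖((T : ℂ) ^ 2 - a * z) / T‖ := by
        rw [norm_div, Complex.norm_of_nonneg hT0.le]
        have : ‖z - a‖ * T ^ 2 ≤ 5 / 4 * ‖(T : ℂ) ^ 2 - a * z‖ := by
          refine le_of_sq_le_sq ?_ (by positivity)
          rw [mul_pow, mul_pow, hsq, hsq]
          have hre : ((T : ℂ) ^ 2 - a * z).re = T ^ 2 - a * z.re := by
            simp [← Complex.ofReal_pow]
          have him : ((T : ℂ) ^ 2 - a * z).im = - (a * z.im) := by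
            simp [← Complex.ofReal_pow]
          rw [hre, him]
          simp only [Complex.sub_re, Complex.sub_im, Complex.ofReal_re, Complex.ofReal_im]
          have hρ : z.re ^ 2 + z.im ^ 2 ≤ (1 / 4) ^ 2 := by
            rw [← hsq]; gcongr
          have ha2 : a ^ 2 ≤ 1 := by rw [← sq_abs]; exact pow_le_one₀ (abs_nonneg a) ha1
          have hp : -(1 / 4) ≤ a * z.re := by
            refine (abs_le.1 (abs_le_of_sq_le_sq ?_ (by norm_num))).1
            nlinarith [sq_nonneg z.im, sq_nonneg z.re]
          have hS : 25 / 16 < T ^ 2 := by nlinarith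
          have h1 := mul_nonneg (mul_nonneg (sq_nonneg T) (sub_nonneg.2 hS.le))
            (by linarith : 0 ≤ a * z.re + 1 / 4)
          have h2 := mul_nonneg (sq_nonneg (T ^ 2)) (by linarith :
            0 ≤ 17 / 16 - (z.re ^ 2 + z.im ^ 2) - a ^ 2)
          have h3 : 0 ≤ a ^ 2 * (z.re ^ 2 + z.im ^ 2) := by positivity
          nlinarith
        rw [div_mul_div_comm, le_div_iff₀ (by positivity)]
        nlinarith
      rw [key z, norm_mul]
      rw [norm_mul] at hB
      calc ‖z - a‖ * ‖dslope g a z‖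
          ≤ 5 / 4 / T * ‖((T : ℂ) ^ 2 - a * z) / T‖ * ‖dslope g a z‖ := by gcongr
        _ = 5 / 4 / T * (‖dslope g a z‖ * ‖((T : ℂ) ^ 2 - a * z) / T‖) := by ring
        _ ≤ 5 / 4 / T * (M * (5 / 4 / T) ^ Z.card) := by gcongr
        _ = _ := by ring
    · intro w hw
      refine le_trans (le_of_eq ?_) (hM w hw)
      rw [key w, norm_mul, norm_mul, mul_comm]
      congr 1
      rw [norm_div, Complex.norm_of_nonneg hT0.le, div_eq_iff hT0.ne']
      refine (sq_eq_sq₀ (norm_nonneg _) (by positivity)).1 ?_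
      have h2 := hsq w
      rw [hw] at h2
      rw [mul_pow, hsq, hsq]
      simp only [← Complex.ofReal_pow, Complex.sub_re, Complex.sub_im, Complex.ofReal_re,
        Complex.ofReal_im, Complex.re_ofReal_mul, Complex.im_ofReal_mul]
      linear_combination (T ^ 2 - a ^ 2) * h2
    · intro x hx
      obtain ⟨hx1, hgx⟩ := hz x (Finset.mem_insert_of_mem hx)
      refine ⟨hx1, ?_⟩
      rw [key] at hgx
      have : (x : ℂ) - a ≠ 0 := by
        rw [sub_ne_zero]
        intro h
        rw [Complex.ofReal_inj] at h
        exact haZ (h ▸ hx)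
      simp [(mul_eq_zero.1 hgx).resolve_left this]
/-- Growth of solutions of a triangular system of first-order linear differential equations. -/
lemma norm_le_of_hasDerivAt_chain {D : ℝ} (s : ℕ) :
    ∀ (F : ℕ → ℂ → ℂ) (w : ℕ → ℂ), (∀ n, ‖w n‖ ≤ D) →
      (∀ n z, HasDerivAt (F n) (w n * F n z + F (n + 1) z) z) → (∀ z, F s z = 0) →
      ∀ z, ‖F 0 z‖ ≤
        Real.exp (D * ‖z‖) * ∑ m ∈ Finset.range s, ‖F m 0‖ * (‖z‖ ^ m / m.factorial) := by
  induction s with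
  | zero => intro F w _ _ h z; simp [h]
  | succ s ih =>
    intro F w hw hF hs z
    have hG := ih (fun n => F (n + 1)) (fun n => w (n + 1)) (fun n => hw _)
      (fun n z => hF _ z) hs
    have hexp : ∀ t : ℝ, t ≤ 1 → ‖Complex.exp (w 0 * z * (1 - t))‖ ≤
        Real.exp (D * ‖z‖ * (1 - t)) := fun t ht => by
      refine (Complex.norm_exp_le_exp_norm _).trans (Real.exp_le_exp.2 ?_)
      have : ‖(1 - t : ℂ)‖ = 1 - t := by
        rw [← Complex.ofReal_one, ← Complex.ofReal_sub, Complex.norm_of_nonneg (by linarith)]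
      rw [norm_mul, norm_mul, this]
      have := sub_nonneg.2 ht
      gcongr
      exact hw 0
    have hf : ∀ t : ℝ, HasDerivAt (fun t : ℝ => Complex.exp (w 0 * z * (1 - t)) * F 0 (t * z))
        (Complex.exp (w 0 * z * (1 - t)) * (z * F 1 (t * z))) t := fun t => by
      have h1 : HasDerivAt (fun u : ℂ => Complex.exp (w 0 * z * (1 - u)))
          (Complex.exp (w 0 * z * (1 - t)) * (w 0 * z * (-1))) t :=
        (((hasDerivAt_id (t : ℂ)).const_sub 1).const_mul (w 0 * z)).cexp
      have h2 : HasDerivAt (fun u : ℂ => F 0 (u * z))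
          ((w 0 * F 0 (t * z) + F 1 (t * z)) * (1 * z)) t :=
        (hF 0 (t * z)).comp (t : ℂ) ((hasDerivAt_id (t : ℂ)).mul_const z)
      have h3 := (h1.mul h2).comp_ofReal
      refine h3.congr_deriv ?_
      ring
    have hB : ∀ t : ℝ, HasDerivAt (fun t : ℝ => Real.exp (D * ‖z‖) * (‖F 0 0‖ +
          ∑ m ∈ Finset.range s, ‖F (m + 1) 0‖ * (t * ‖z‖) ^ (m + 1) / (m + 1).factorial))
        (Real.exp (D * ‖z‖) *
          (‖z‖ * ∑ m ∈ Finset.range s, ‖F (m + 1) 0‖ * ((t * ‖z‖) ^ m / m.factorial))) t := by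
      intro t
      refine HasDerivAt.const_mul _ (HasDerivAt.const_add _ ?_)
      rw [Finset.mul_sum]
      refine HasDerivAt.fun_sum fun m _ => ?_
      have h1 := ((((hasDerivAt_id t).mul_const ‖z‖).pow (m + 1)).const_mul
        ‖F (m + 1) 0‖).div_const ((m + 1).factorial : ℝ)
      refine h1.congr_deriv ?_
      have : (m.factorial : ℝ) ≠ 0 := by positivity
      rw [Nat.factorial_succ]
      push_cast
      simp only [id]
      field_simp
    have := image_norm_le_of_norm_deriv_right_le_deriv_boundary (a := 0) (b := 1)
      (fun t _ => (hf t).continuousAt.continuousWithinAt)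
      (fun t _ => (hf t).hasDerivWithinAt) (B := _) (B' := _) ?_ hB ?_
      (Set.right_mem_Icc.2 zero_le_one)
    · simp only [Complex.ofReal_one, sub_self, mul_zero, Complex.exp_zero, one_mul] at this
      refine this.trans (le_of_eq ?_)
      rw [Finset.sum_range_succ', add_comm]
      simp [mul_div_assoc]
    · have h0 := hexp 0 zero_le_one
      simp only [Complex.ofReal_zero, sub_zero, mul_one] at h0
      simp only [Complex.ofReal_zero, sub_zero, mul_one, zero_mul, norm_mul]
      simpa using mul_le_mul_of_nonneg_right h0 (norm_nonneg (F 0 0))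
    · intro t ht
      have h1 := hG (t * z)
      have h2 := hexp t ht.2.le
      have h3 : ‖(t : ℂ) * z‖ = t * ‖z‖ := by
        rw [norm_mul, Complex.norm_of_nonneg ht.1]
      rw [h3] at h1
      rw [norm_mul, norm_mul]
      calc _ ≤ Real.exp (D * ‖z‖ * (1 - t)) * (‖z‖ * (Real.exp (D * (t * ‖z‖)) *
            ∑ m ∈ Finset.range s, ‖F (m + 1) 0‖ * ((t * ‖z‖) ^ m / m.factorial))) := by
            gcongr
        _ = Real.exp (D * ‖z‖ * (1 - t) + D * (t * ‖z‖)) * (‖z‖ *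
            ∑ m ∈ Finset.range s, ‖F (m + 1) 0‖ * ((t * ‖z‖) ^ m / m.factorial)) := by
            rw [Real.exp_add]; ring
        _ = _ := by congr 2; ring

open Polynomial in
/-- Bound for a linear functional on polynomials with small moments, evaluated at a product of
linear factors. -/
lemma norm_sum_eval_prod_le {ι : Type*} [Fintype ι] {D r M : ℝ} (hD : 0 ≤ D) (hr : 0 < r)
    (hM : 0 ≤ M) (c w : ι → ℂ) (v : ℕ → ℂ) (hv : ∀ n, ‖v n‖ ≤ D)
    (hmom : ∀ k : ℕ, ‖∑ j, c j * w j ^ k‖ ≤ k.factorial * M / r ^ k) (n : ℕ) :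
    ‖∑ j, c j * ∏ i ∈ Finset.range n, (w j - v i)‖ ≤
      n.factorial / r ^ n * Real.exp (D * r) * M := by
  set P : ℂ[X] := ∏ i ∈ Finset.range n, (X - C (v i)) with hP
  have hmonic : P.Monic := monic_prod_of_monic _ _ fun i _ => monic_X_sub_C _
  have hdeg : P.natDegree = n := by
    rw [hP, natDegree_prod_of_monic _ _ fun i _ => monic_X_sub_C _]; simp
  have hcoeff : ∀ k, ‖P.coeff k‖ ≤ D ^ (n - k) * n.choose k := fun k => by
    have := coeff_le_of_roots_le (f := RingHom.id ℂ) (B := D) (p := P) k hmonic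
      (IsAlgClosed.splits _) ?_
    · simpa [hdeg] using this
    · intro z hz
      have hroot := isRoot_of_mem_roots hz
      rw [Polynomial.map_id, hP, IsRoot.def, eval_prod, Finset.prod_eq_zero_iff] at hroot
      obtain ⟨i, -, hi⟩ := hroot
      rw [eval_sub, eval_X, eval_C, sub_eq_zero] at hi
      exact hi ▸ hv i
  have heval : ∀ j, ∏ i ∈ Finset.range n, (w j - v i) =
      ∑ k ∈ Finset.range (n + 1), P.coeff k * w j ^ k := fun j => by
    rw [← hdeg, ← eval_eq_sum_range, hP, eval_prod]; simp
  have hswap : ∑ j, c j * ∏ i ∈ Finset.range n, (w j - v i) =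
      ∑ k ∈ Finset.range (n + 1), P.coeff k * ∑ j, c j * w j ^ k := by
    simp_rw [heval, Finset.mul_sum]
    rw [Finset.sum_comm]
    refine Finset.sum_congr rfl fun k _ => Finset.sum_congr rfl fun j _ => by ring
  rw [hswap]
  calc _ ≤ ∑ k ∈ Finset.range (n + 1), D ^ (n - k) * n.choose k * (k.factorial * M / r ^ k) := by
        refine (norm_sum_le _ _).trans (Finset.sum_le_sum fun k _ => ?_)
        rw [norm_mul]
        gcongr
        · exact hcoeff k
        · exact hmom k
    _ = ∑ k ∈ Finset.range (n + 1), n.factorial / r ^ n * M *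
          ((D * r) ^ (n - k) / (n - k).factorial) := by
        refine Finset.sum_congr rfl fun k hk => ?_
        have hk' : k ≤ n := by simpa [Nat.lt_succ_iff] using hk
        rw [Nat.cast_choose ℝ hk', mul_pow, show r ^ n = r ^ (n - k) * r ^ k by
          rw [← pow_add, Nat.sub_add_cancel hk']]
        field_simp
    _ = n.factorial / r ^ n * M *
          ∑ k ∈ Finset.range (n + 1), ((D * r) ^ k / k.factorial) := by
        rw [← Finset.mul_sum, ← Finset.sum_range_reflect (fun k => (D * r) ^ k / (k.factorial : ℝ))]
        simp
    _ ≤ n.factorial / r ^ n * M * Real.exp (D * r) := by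
        gcongr
        exact Real.sum_le_exp_of_nonneg (by positivity) _
    _ = _ := by ring

lemma iteratedDeriv_exp_sum {ι : Type*} [Fintype ι] (c w : ι → ℂ) (k : ℕ) :
    iteratedDeriv k (fun z => ∑ j, c j * Complex.exp (w j * z)) =
      fun z => ∑ j, c j * w j ^ k * Complex.exp (w j * z) := by
  induction k with
  | zero => simp
  | succ k ih =>
    rw [iteratedDeriv_succ, ih]
    funext z
    refine HasDerivAt.deriv ?_
    refine HasDerivAt.fun_sum fun j _ => ?_
    refine ((((hasDerivAt_id z).const_mul (w j)).cexp).const_mul (c j * w j ^ k)).congr_deriv ?_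
    simp only [id]
    ring

lemma norm_moment_le {ι : Type*} [Fintype ι] {r M : ℝ} (hr : 0 < r) (c w : ι → ℂ)
    (hM : ∀ z, ‖z‖ = r → ‖∑ j, c j * Complex.exp (w j * z)‖ ≤ M) (k : ℕ) :
    ‖∑ j, c j * w j ^ k‖ ≤ k.factorial * M / r ^ k := by
  have hd : Differentiable ℂ fun z => ∑ j, c j * Complex.exp (w j * z) := by fun_prop
  have := Complex.norm_iteratedDeriv_le_of_forall_mem_sphere_norm_le (c := 0) k hr
    hd.diffContOnCl (fun z hz => hM z (by simpa using hz))
  simpa [iteratedDeriv_exp_sum] using this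

/-- Growth of an exponential sum with `s` terms. -/
lemma norm_exp_sum_le {s : ℕ} {D r M : ℝ} (hD : 0 ≤ D) (hr : 0 < r) (hM0 : 0 ≤ M)
    (c w : Fin s → ℂ) (hw : ∀ j, ‖w j‖ ≤ D)
    (hM : ∀ z, ‖z‖ = r → ‖∑ j, c j * Complex.exp (w j * z)‖ ≤ M) (z : ℂ) :
    ‖∑ j, c j * Complex.exp (w j * z)‖ ≤
      Real.exp (D * ‖z‖) * Real.exp (D * r) * M * ∑ m ∈ Finset.range s, (‖z‖ / r) ^ m := by
  set v : ℕ → ℂ := fun n => if h : n < s then w ⟨n, h⟩ else 0 with hv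
  have hvD : ∀ n, ‖v n‖ ≤ D := fun n => by
    simp only [hv]
    split_ifs
    · exact hw _
    · simpa using hD
  set F : ℕ → ℂ → ℂ := fun n z =>
    ∑ j, c j * (∏ i ∈ Finset.range n, (w j - v i)) * Complex.exp (w j * z) with hF
  have hderiv : ∀ n z, HasDerivAt (F n) (v n * F n z + F (n + 1) z) z := fun n z => by
    have : HasDerivAt (F n) (∑ j, c j * (∏ i ∈ Finset.range n, (w j - v i)) *
        (Complex.exp (w j * z) * (w j * 1))) z :=
      HasDerivAt.fun_sum fun j _ => (((hasDerivAt_id z).const_mul (w j)).cexp).const_mul _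
    refine this.congr_deriv ?_
    simp only [hF, Finset.mul_sum, ← Finset.sum_add_distrib, Finset.prod_range_succ]
    exact Finset.sum_congr rfl fun j _ => by ring
  have hzero : ∀ z, F s z = 0 := fun z => by
    refine Finset.sum_eq_zero fun j _ => ?_
    rw [Finset.prod_eq_zero (Finset.mem_range.2 j.2) (by simp [hv])]
    simp
  have h := norm_le_of_hasDerivAt_chain s F v hvD hderiv hzero z
  have h0 : F 0 z = ∑ j, c j * Complex.exp (w j * z) := by simp [hF]
  rw [← h0]
  refine h.trans ?_
  rw [mul_assoc, mul_assoc, ← mul_assoc (Real.exp (D * r)), Finset.mul_sum (Finset.range s) _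
    (Real.exp (D * r) * M)]
  refine mul_le_mul_of_nonneg_left (Finset.sum_le_sum fun m _ => ?_) (Real.exp_pos _).le
  have hm := norm_sum_eval_prod_le hD hr hM0 c w v hvD (norm_moment_le hr c w hM) m
  have hFm : F m 0 = ∑ j, c j * ∏ i ∈ Finset.range m, (w j - v i) := by simp [hF]
  rw [hFm]
  calc _ ≤ m.factorial / r ^ m * Real.exp (D * r) * M * (‖z‖ ^ m / m.factorial) := by gcongr
    _ = _ := by
      have : (m.factorial : ℝ) ≠ 0 := by positivity
      rw [div_pow]
      field_simp

lemma geom_sum_le_pow {x : ℝ} (hx : 2 ≤ x) (s : ℕ) : ∑ m ∈ Finset.range s, x ^ m ≤ x ^ s := by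
  induction s with
  | zero => simp
  | succ s ih =>
    rw [Finset.sum_range_succ, pow_succ]
    have : 0 < x ^ s := by positivity
    nlinarith

/-- Zero bound for exponential sums with exponents in the disc of radius `π s / a`. -/
lemma exp_sum_coeff_eq_zero {s : ℕ} {a : ℝ} (ha : 1 < a) (c w : Fin s → ℂ)
    (hw : ∀ j, ‖w j‖ ≤ π * s / a) (hinj : Function.Injective w) (Z : Finset ℝ)
    (hcard : (1 + 6 / Real.log a) * s < Z.card)
    (hZ : ∀ x ∈ Z, |x| ≤ 1 ∧ ∑ j, c j * Complex.exp (w j * x) = 0) : ∀ j, c j = 0 := by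
  obtain ⟨T, hT, hTa⟩ := exists_radius_log_le ha
  have ha0 : 0 < a := by linarith
  have hT0 : 0 < T := by linarith
  set D := π * s / a with hDdef
  have hD : 0 ≤ D := by positivity
  set g : ℂ → ℂ := fun z => ∑ j, c j * Complex.exp (w j * z) with hg
  have hd : Differentiable ℂ g := by fun_prop
  obtain ⟨z₀, hz₀, hmax⟩ := (isCompact_closedBall (0 : ℂ) (1 / 4)).exists_isMaxOn
    ⟨0, by simp⟩ hd.continuous.norm.continuousOn
  have hz₀' : ‖z₀‖ ≤ 1 / 4 := by simpa using hz₀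
  have hM : ∀ z : ℂ, ‖z‖ = 1 / 4 → ‖g z‖ ≤ ‖g z₀‖ := fun z hz =>
    hmax (by rw [mem_closedBall_zero_iff, hz])
  have hgrow : ∀ z, ‖z‖ = T →
      ‖g z‖ ≤ Real.exp (D * T) * Real.exp (D * (1 / 4)) * ‖g z₀‖ * (4 * T) ^ s := fun z hz => by
    refine (norm_exp_sum_le hD (by norm_num) (norm_nonneg _) c w hw hM z).trans ?_
    rw [hz]
    gcongr
    refine (geom_sum_le_pow (by linarith) s).trans (le_of_eq ?_)
    congr 1; ring
  have hdecay := norm_le_of_zeros (by linarith) Z g hd hgrow hZ z₀ hz₀'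
  have hlt : Real.exp (D * T) * Real.exp (D * (1 / 4)) * (4 * T) ^ s * (5 / 4 / T) ^ Z.card < 1 := by
    have h1 : (4 * T) ^ s = Real.exp (s * Real.log (4 * T)) := by
      rw [mul_comm (s : ℝ), Real.exp_mul, Real.exp_log (by positivity), Real.rpow_natCast]
    have h2 : (5 / 4 / T) ^ Z.card = Real.exp (-(Z.card * Real.log (T / (5 / 4)))) := by
      rw [← mul_neg, ← Real.log_inv, inv_div, mul_comm (Z.card : ℝ), Real.exp_mul,
        Real.exp_log (by positivity), Real.rpow_natCast]
    rw [h1, h2, ← Real.exp_add, ← Real.exp_add, ← Real.exp_add, Real.exp_lt_one_iff]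
    have hlog : 0 < Real.log (T / (5 / 4)) := by
      apply Real.log_pos
      rw [lt_div_iff₀] <;> linarith
    have h3 := mul_lt_mul_of_pos_right hcard hlog
    have h4 : Real.log (4 * T) = Real.log 5 + Real.log (T / (5 / 4)) := by
      rw [← Real.log_mul (by norm_num) (by positivity)]; congr 1; ring
    have h5 := mul_le_mul_of_nonneg_left hTa (Nat.cast_nonneg (α := ℝ) s)
    have h6 : D * T + D * (1 / 4) = s * (π / a * (T + 1 / 4)) := by rw [hDdef]; ring
    rw [h4]
    linarith
  have hzero : ‖g z₀‖ = 0 := by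
    by_contra hne
    have : 0 < ‖g z₀‖ := lt_of_le_of_ne (norm_nonneg _) (Ne.symm hne)
    nlinarith
  rw [hzero] at hM
  have hmom := norm_moment_le (by norm_num) c w hM
  have := Matrix.eq_zero_of_forall_pow_sum_mul_pow_eq_zero hinj (v := c)
    (fun i => by simpa using hmom i)
  exact fun j => congrFun this j

/-- Tijdeman's zero bound: if the Fourier transform of `μ = ∑ cⱼ δ_{tⱼ}` with
`tⱼ ∈ [0,Λ]` vanishes at more than `(1 + 6/ln(s/(ΛΩ)))·s` points of `[-Ω,Ω]`
(with `s > ΛΩ`), then all coefficients vanish. -/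
theorem stmt3 (Λ Ω : ℝ) (hΛ : 0 < Λ) (hΩ : 0 < Ω) (s : ℕ) (hs : Λ * Ω < s)
    (t : Fin s → ℝ) (ht : Function.Injective t) (htmem : ∀ j, t j ∈ Set.Icc 0 Λ)
    (c : Fin s → ℂ) (Z : Finset ℝ) (hZ : ↑Z ⊆ Set.Icc (-Ω) Ω)
    (hcard : (1 + 6 / Real.log (s / (Λ * Ω))) * s < (Z.card : ℝ))
    (hvanish : ∀ ω ∈ Z, ∑ j, c j * Complex.exp (-2 * π * I * ω * t j) = 0) :
    ∀ j, c j = 0 := by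
  have hΛΩ : 0 < Λ * Ω := by positivity
  have hs0 : (0 : ℝ) < s := hΛΩ.trans hs
  set w : Fin s → ℂ := fun j => ((π * Ω * (Λ - 2 * t j) : ℝ) : ℂ) * I with hw
  refine exp_sum_coeff_eq_zero (a := s / (Λ * Ω)) ((one_lt_div hΛΩ).2 hs) c w ?_ ?_
    (Z.image fun x => x / Ω) ?_ ?_
  · intro j
    obtain ⟨h0, h1⟩ := htmem j
    have habs : |Λ - 2 * t j| ≤ Λ := abs_le.2 ⟨by linarith, by linarith⟩
    have : π * s / (s / (Λ * Ω)) = π * Ω * Λ := by field_simp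
    rw [this, norm_mul, Complex.norm_I, mul_one, Complex.norm_real, Real.norm_eq_abs, abs_mul,
      abs_of_pos (by positivity)]
    gcongr
  · intro i j hij
    have h1 := Complex.ofReal_injective (mul_right_cancel₀ I_ne_zero hij)
    have h2 := mul_left_cancel₀ (by positivity) h1
    exact ht (by linarith)
  · rwa [Finset.card_image_of_injective _ fun x y h => (div_left_inj' hΩ.ne').1 h]
  · intro x hx
    obtain ⟨ω, hω, rfl⟩ := Finset.mem_image.1 hx
    obtain ⟨h0, h1⟩ := hZ hω
    constructor
    · rw [abs_div, abs_of_pos hΩ, div_le_one hΩ]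
      exact abs_le.2 ⟨h0, h1⟩
    · have hΩ' : (Ω : ℂ) ≠ 0 := by exact_mod_cast hΩ.ne'
      have : ∑ j, c j * Complex.exp (w j * ((ω / Ω : ℝ) : ℂ)) =
          Complex.exp (π * Λ * ω * I) * ∑ j, c j * Complex.exp (-2 * π * I * ω * t j) := by
        rw [Finset.mul_sum]
        refine Finset.sum_congr rfl fun j _ => ?_
        rw [mul_left_comm, ← Complex.exp_add]
        congr 2
        simp only [hw]
        push_cast
        field_simp
        ring
      rw [this, hvanish ω hω, mul_zero]
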